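/- For every permutation π of the index set {1,2,3}, the eight 4×4 matrices obtained by replacing γ̂_k with γ̂_{π(k)} (and correspondingly σ̂_k with γ̂_{π(k)} γ̂_0) in the defining equations λ_1 = î(γ̂_1 − σ̂_1)/2, λ_2 = î(γ̂_2 − σ̂_2)/2, λ_4 = (j σ̂_1 + γ̂_2)/2, λ_5 = (j σ̂_2 − γ̂_1)/2, λ_3 = −λ_1 λ_2, λ_6 = λ_1 λ_5 − λ_5 λ_1, λ_7 = λ_5 λ_2 − λ_2 λ_5, λ_8 = (−2 λ_4 λ_5 − λ_3)/√3 (with î := γ̂_0 γ̂_1 γ̂_2 γ̂_3 kept fixed), satisfy the su(3) commutation relations λ_a λ_b − λ_b λ_a = −2 Σ_{c=1}^{8} f_{abc} λ_c for all a, b ∈ {1,…,8}. -/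

import Mathlib

open Matrix Complex

noncomputable section

/-- The Dirac–Pauli gamma matrices. -/
def γ : Fin 4 → Matrix (Fin 4) (Fin 4) ℂ :=
  ![!![1, 0, 0, 0; 0, 1, 0, 0; 0, 0, -1, 0; 0, 0, 0, -1],
    !![0, 0, 0, -1; 0, 0, -1, 0; 0, 1, 0, 0; 1, 0, 0, 0],
    !![0, 0, 0, I; 0, 0, -I, 0; 0, -I, 0, 0; I, 0, 0, 0],
    !![0, 0, -1, 0; 0, 0, 0, 1; 1, 0, 0, 0; 0, -1, 0, 0]]

/-- The 4×4 relative-space matrices σ̂_μ (with σ̂_0 = γ̂_0 and σ̂_k = γ̂_k γ̂_0). -/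
def σ4 : Fin 4 → Matrix (Fin 4) (Fin 4) ℂ := fun μ => γ μ * γ 0

/-- The pseudoscalar î := γ̂_0 γ̂_1 γ̂_2 γ̂_3. -/
def ii : Matrix (Fin 4) (Fin 4) ℂ := γ 0 * γ 1 * γ 2 * γ 3

/-- Auxiliary lookup: nonzero values of the su(3) structure constants on a chosen
set of base triples (indices `0,…,7` correspond to `1,…,8`):
`f_{123} = 1`, `f_{147} = f_{246} = f_{257} = f_{345} = f_{516} = f_{637} = 1/2`,
`f_{458} = f_{678} = √3/2`. -/
def fAux : Fin 8 → Fin 8 → Fin 8 → ℝ := fun a b c =>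
  if a = 0 ∧ b = 1 ∧ c = 2 then 1
  else if a = 0 ∧ b = 3 ∧ c = 6 then 1/2
  else if a = 1 ∧ b = 3 ∧ c = 5 then 1/2
  else if a = 1 ∧ b = 4 ∧ c = 6 then 1/2
  else if a = 2 ∧ b = 3 ∧ c = 4 then 1/2
  else if a = 4 ∧ b = 0 ∧ c = 5 then 1/2
  else if a = 5 ∧ b = 2 ∧ c = 6 then 1/2
  else if a = 3 ∧ b = 4 ∧ c = 7 then Real.sqrt 3 / 2
  else if a = 5 ∧ b = 6 ∧ c = 7 then Real.sqrt 3 / 2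
  else 0

/-- The su(3) structure constants `f_{abc}`: totally antisymmetric in the indices,
generated by the nonvanishing base values recorded in `fAux`. -/
def f (a b c : Fin 8) : ℝ :=
  fAux a b c - fAux a c b + fAux b c a - fAux b a c + fAux c a b - fAux c b a

/-- γ̂_{π(k)} : the gamma matrix with spatial index k (k : Fin 3 standing for
the index k+1 ∈ {1,2,3}) permuted by π. -/
def γP (π : Equiv.Perm (Fin 3)) (k : Fin 3) : Matrix (Fin 4) (Fin 4) ℂ :=
  γ (π k).succ

/-- The correspondingly permuted relative-space matrices σ̂_k = γ̂_{π(k)} γ̂_0. -/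
def σP (π : Equiv.Perm (Fin 3)) (k : Fin 3) : Matrix (Fin 4) (Fin 4) ℂ :=
  γP π k * γ 0

def l1 (π : Equiv.Perm (Fin 3)) : Matrix (Fin 4) (Fin 4) ℂ :=
  (2 : ℂ)⁻¹ • (ii * (γP π 0 - σP π 0))
def l2 (π : Equiv.Perm (Fin 3)) : Matrix (Fin 4) (Fin 4) ℂ :=
  (2 : ℂ)⁻¹ • (ii * (γP π 1 - σP π 1))
def l4 (π : Equiv.Perm (Fin 3)) : Matrix (Fin 4) (Fin 4) ℂ :=
  (2 : ℂ)⁻¹ • (I • σP π 0 + γP π 1)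
def l5 (π : Equiv.Perm (Fin 3)) : Matrix (Fin 4) (Fin 4) ℂ :=
  (2 : ℂ)⁻¹ • (I • σP π 1 - γP π 0)
def l3 (π : Equiv.Perm (Fin 3)) : Matrix (Fin 4) (Fin 4) ℂ := -(l1 π * l2 π)
def l6 (π : Equiv.Perm (Fin 3)) : Matrix (Fin 4) (Fin 4) ℂ :=
  l1 π * l5 π - l5 π * l1 π
def l7 (π : Equiv.Perm (Fin 3)) : Matrix (Fin 4) (Fin 4) ℂ :=
  l5 π * l2 π - l2 π * l5 π
def l8 (π : Equiv.Perm (Fin 3)) : Matrix (Fin 4) (Fin 4) ℂ :=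
  (Real.sqrt 3 : ℂ)⁻¹ • ((-2 : ℂ) • (l4 π * l5 π) - l3 π)

/-- The permuted λ-multivector representatives, indexed by `Fin 8`. -/
def lam (π : Equiv.Perm (Fin 3)) : Fin 8 → Matrix (Fin 4) (Fin 4) ℂ :=
  ![l1 π, l2 π, l3 π, l4 π, l5 π, l6 π, l7 π, l8 π]

lemma γ_zero_mul_self : γ 0 * γ 0 = 1 := by
  ext i j; fin_cases i <;> fin_cases j <;> simp [γ, Matrix.mul_apply, Fin.sum_univ_four]

lemma γ_succ_mul_self (k : Fin 3) : γ k.succ * γ k.succ = -1 := by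
  fin_cases k <;> ext i j <;> fin_cases i <;> fin_cases j <;>
    simp [γ, Matrix.mul_apply, Fin.sum_univ_four]

set_option maxHeartbeats 1000000 in
/-- Distinct gamma matrices anticommute. -/
lemma γ_anticomm {μ ν : Fin 4} (h : μ ≠ ν) : γ μ * γ ν = -(γ ν * γ μ) := by
  fin_cases μ <;> fin_cases ν <;> first
    | exact absurd rfl h
    | ext i j
      fin_cases i <;> fin_cases j <;> simp [γ, Matrix.mul_apply, Fin.sum_univ_four]

lemma ii_eq : ii = !![0, 0, I, 0; 0, 0, 0, I; I, 0, 0, 0; 0, I, 0, 0] := by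
  ext i j; fin_cases i <;> fin_cases j <;> simp [ii, γ, Matrix.mul_apply, Fin.sum_univ_four]

lemma ii_mul_self : ii * ii = -1 := by
  rw [ii_eq]
  ext i j; fin_cases i <;> fin_cases j <;> simp [Matrix.mul_apply, Fin.sum_univ_four]

lemma γ_mul_ii (μ : Fin 4) : γ μ * ii = -(ii * γ μ) := by
  rw [ii_eq]
  fin_cases μ <;> ext i j <;> fin_cases i <;> fin_cases j <;>
    simp [γ, Matrix.mul_apply, Fin.sum_univ_four]

/-- Four anticommuting square roots of `±1` in a complex algebra, with the signs of
`ii`, two distinct spatial gamma matrices and `γ 0`. -/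
structure CliffordQuadruple {A : Type*} [Ring A] (i x y g : A) : Prop where
  ii : i * i = -1
  xx : x * x = -1
  yy : y * y = -1
  gg : g * g = 1
  xi : x * i = -(i * x)
  yi : y * i = -(i * y)
  gi : g * i = -(i * g)
  yx : y * x = -(x * y)
  gx : g * x = -(x * g)
  gy : g * y = -(y * g)

lemma cliffordQuadruple_γP (π : Equiv.Perm (Fin 3)) :
    CliffordQuadruple ii (γP π 0) (γP π 1) (γ 0) where
  ii := ii_mul_self
  xx := γ_succ_mul_self _
  yy := γ_succ_mul_self _
  gg := γ_zero_mul_self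
  xi := γ_mul_ii _
  yi := γ_mul_ii _
  gi := γ_mul_ii _
  yx := γ_anticomm (by simp)
  gx := γ_anticomm (Fin.succ_ne_zero _).symm
  gy := γ_anticomm (Fin.succ_ne_zero _).symm

/-- The eight generators expanded in the monomials of a Clifford quadruple; `r` stands for
`√3`. -/
def cliffordLam {A : Type*} [Ring A] [Algebra ℂ A] (i x y g : A) (r : ℂ) : Fin 8 → A :=
  ![(2 : ℂ)⁻¹ • (i * x - i * (x * g)),
    (2 : ℂ)⁻¹ • (i * y - i * (y * g)),
    (2 : ℂ)⁻¹ • (x * (y * g) - x * y),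
    (2 : ℂ)⁻¹ • (I • (x * g) + y),
    (2 : ℂ)⁻¹ • (I • (y * g) - x),
    (2 : ℂ)⁻¹ • (I • (i * (x * y)) + i),
    (2 : ℂ)⁻¹ • (I • (i * g) - i * (x * (y * g))),
    r⁻¹ • (I • g - (2 : ℂ)⁻¹ • (x * y) - (2 : ℂ)⁻¹ • (x * (y * g)))]

lemma mul_mul_eq_neg {A : Type*} [Ring A] {a b c : A} (h : a * b = -c) (d : A) :
    a * (b * d) = -(c * d) := by
  rw [← mul_assoc, h, neg_mul]

lemma f_swap (a b c : Fin 8) : f b a c = -f a b c := by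
  simp only [f]; ring

set_option maxHeartbeats 4000000 in
/-- The `su(3)` commutation relations follow from the Clifford relations alone. -/
lemma cliffordLam_commutator {A : Type*} [Ring A] [Algebra ℂ A] {i x y g : A}
    (h : CliffordQuadruple i x y g) (a b : Fin 8) :
    cliffordLam i x y g (Real.sqrt 3) a * cliffordLam i x y g (Real.sqrt 3) b -
      cliffordLam i x y g (Real.sqrt 3) b * cliffordLam i x y g (Real.sqrt 3) a =
      (-2 : ℂ) • ∑ c : Fin 8, (f a b c : ℂ) • cliffordLam i x y g (Real.sqrt 3) c := by
  obtain ⟨hii, hxx, hyy, hgg, hxi, hyi, hgi, hyx, hgx, hgy⟩ := h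
  have hr : ((Real.sqrt 3 : ℝ) : ℂ) ^ 2 = 3 := by
    rw [← Complex.ofReal_pow, Real.sq_sqrt (by norm_num)]; norm_num
  have hrinv : ((Real.sqrt 3 : ℝ) : ℂ)⁻¹ = (Real.sqrt 3 : ℝ) / 3 := by
    field_simp; exact hr.symm
  wlog hab : a < b generalizing a b
  · rcases eq_or_lt_of_not_gt hab with rfl | hba
    · have hf (c : Fin 8) : f b b c = 0 := by simp only [f]; ring
      simp [hf]
    · rw [← neg_sub, this b a hba]
      simp [f_swap b a]
  simp only [Fin.sum_univ_eight, cliffordLam, hrinv]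
  generalize hs : ((Real.sqrt 3 : ℝ) : ℂ) = r at *
  fin_cases a <;> fin_cases b <;> first
    | exact absurd hab (by decide)
    | simp [f, fAux, hs, mul_add, add_mul, mul_sub, sub_mul, mul_assoc,
        smul_smul, hgg, hxx, hyy, hxi, hyi, hgi, hyx, hgx, hgy,
        mul_mul_eq_neg hii, mul_mul_eq_neg hxx, mul_mul_eq_neg hyy, mul_mul_eq_neg hxi,
        mul_mul_eq_neg hyi, mul_mul_eq_neg hgi, mul_mul_eq_neg hyx, mul_mul_eq_neg hgx,
        mul_mul_eq_neg hgy]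
      match_scalars <;> ring_nf <;> simp [hr, I_sq] <;> ring

lemma lam_eq_cliffordLam (π : Equiv.Perm (Fin 3)) :
    lam π = cliffordLam ii (γP π 0) (γP π 1) (γ 0) (Real.sqrt 3) := by
  obtain ⟨hii, hxx, hyy, hgg, hxi, hyi, hgi, hyx, hgx, hgy⟩ := cliffordQuadruple_γP π
  funext k
  fin_cases k <;>
    simp [lam, cliffordLam, l1, l2, l3, l4, l5, l6, l7, l8, σP,
        add_mul, mul_sub, sub_mul, mul_assoc,
        smul_smul, hgg, hxx, hyy, hyx, hgx, hgy,
        mul_mul_eq_neg hii, mul_mul_eq_neg hxx, mul_mul_eq_neg hyy, mul_mul_eq_neg hxi,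
        mul_mul_eq_neg hyi, mul_mul_eq_neg hgi, mul_mul_eq_neg hyx, mul_mul_eq_neg hgx,
        mul_mul_eq_neg hgy] <;>
    match_scalars <;> ring_nf <;> simp [I_sq] <;> ring

theorem permuted_su3_commutation_relations :
    ∀ π : Equiv.Perm (Fin 3), ∀ a b : Fin 8,
      lam π a * lam π b - lam π b * lam π a =
        (-2 : ℝ) • ∑ c : Fin 8, f a b c • lam π c := by
  intro π a b
  rw [lam_eq_cliffordLam, cliffordLam_commutator (cliffordQuadruple_γP π)]
  simp only [← Complex.coe_smul]
  norm_num

end
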